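/- Let ρ and σ be positive definite d×d complex matrices and let r > 0. Then lim_{α→+∞} D_{α,r(α−1)}(ρ||σ) = r · D_max(ρ^{1/r} || σ^{1/r}), where D_max(A||B) := log₂ min{λ > 0 : A ≤ λB}. In particular, for r = 1 (i.e. z = α − 1 ~ α), lim_{α→+∞} of the α-quantum Rényi divergence equals D_max(ρ||σ). -/

import Mathlib

open Matrix Filter
open scoped ComplexOrder

/-- Real power of a matrix, defined via the Hermitian functional calculus
(with the convention `(0:ℝ) ^ t = 0` for `t ≠ 0` from `Real.rpow`);
junk value `0` for non-Hermitian matrices. -/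
noncomputable def mpow {n : Type*} [Fintype n] [DecidableEq n]
    (A : Matrix n n ℂ) (t : ℝ) : Matrix n n ℂ :=
  if hA : A.IsHermitian then hA.cfc (fun x => x ^ t) else 0

/-- The α-z trace functional `f_{α,z}(ρ‖σ) = Tr((ρ^{α/2z} σ^{(1-α)/z} ρ^{α/2z})^z)`. -/
noncomputable def traceFun {n : Type*} [Fintype n] [DecidableEq n]
    (α z : ℝ) (ρ σ : Matrix n n ℂ) : ℂ :=
  Matrix.trace (mpow (mpow ρ (α / (2 * z)) * mpow σ ((1 - α) / z) * mpow ρ (α / (2 * z))) z)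

/-- The α-z relative Rényi entropy `D_{α,z}(ρ‖σ) = (α-1)⁻¹ log₂ (f_{α,z}(ρ‖σ)/Tr ρ)`. -/
noncomputable def Dent {n : Type*} [Fintype n] [DecidableEq n]
    (α z : ℝ) (ρ σ : Matrix n n ℂ) : ℝ :=
  (α - 1)⁻¹ * Real.logb 2 ((traceFun α z ρ σ).re / (Matrix.trace ρ).re)

/-- The max-relative entropy `D_max(A‖B) = log₂ min{λ > 0 : A ≤ λB}` (Loewner order). -/
noncomputable def Dmax {n : Type*} [Fintype n] [DecidableEq n] (A B : Matrix n n ℂ) : ℝ :=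
  Real.logb 2 (sInf {l : ℝ | 0 < l ∧ (l • B - A).PosSemidef})

section Helpers

open scoped MatrixOrder Matrix.Norms.L2Operator Topology

lemma mpow_eq {d : ℕ} {A : Matrix (Fin d) (Fin d) ℂ} (hA : A.IsHermitian) (t : ℝ) :
    mpow A t = (hA.eigenvectorUnitary : Matrix (Fin d) (Fin d) ℂ) *
      diagonal (fun i => ((hA.eigenvalues i ^ t : ℝ) : ℂ)) *
      star (hA.eigenvectorUnitary : Matrix (Fin d) (Fin d) ℂ) := by
  rw [mpow, dif_pos hA, IsHermitian.cfc, Unitary.conjStarAlgAut_apply]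
  rfl

lemma mpow_mul {d : ℕ} {A : Matrix (Fin d) (Fin d) ℂ} (hA : A.PosDef) (s t : ℝ) :
    mpow A s * mpow A t = mpow A (s + t) := by
  rw [mpow_eq hA.isHermitian, mpow_eq hA.isHermitian, mpow_eq hA.isHermitian]
  have h : (star (hA.isHermitian.eigenvectorUnitary : Matrix (Fin d) (Fin d) ℂ)) *
      (hA.isHermitian.eigenvectorUnitary : Matrix (Fin d) (Fin d) ℂ) = 1 :=
    Unitary.coe_star_mul_self _
  set U := (hA.isHermitian.eigenvectorUnitary : Matrix (Fin d) (Fin d) ℂ)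
  have e : ∀ D E : Matrix (Fin d) (Fin d) ℂ, U * D * star U * (U * E * star U)
      = U * (D * E) * star U := by
    intro D E
    calc U * D * star U * (U * E * star U) = U * D * (star U * U) * E * star U := by
          simp only [mul_assoc]
      _ = _ := by rw [h]; simp only [mul_assoc, mul_one, one_mul]
  rw [e, diagonal_mul_diagonal]
  congr 3
  ext i
  rw [Real.rpow_add (hA.eigenvalues_pos i)]
  push_cast
  rfl

lemma mpow_zero' {d : ℕ} {A : Matrix (Fin d) (Fin d) ℂ} (hA : A.IsHermitian) :
    mpow A 0 = 1 := by
  rw [mpow_eq hA]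
  simp

lemma mpow_one' {d : ℕ} {A : Matrix (Fin d) (Fin d) ℂ} (hA : A.IsHermitian) :
    mpow A 1 = A := by
  rw [mpow, dif_pos hA, ← hA.cfc_eq]
  simp only [Real.rpow_one]
  exact cfc_id' ℝ A hA

lemma mpow_herm {d : ℕ} {A : Matrix (Fin d) (Fin d) ℂ} (hA : A.IsHermitian) (t : ℝ) :
    (mpow A t)ᴴ = mpow A t := by
  rw [mpow_eq hA, star_eq_conjTranspose]
  simp only [conjTranspose_mul, conjTranspose_conjTranspose, diagonal_conjTranspose, mul_assoc]
  congr 3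
  ext i
  simp

lemma mpow_trace {d : ℕ} {A : Matrix (Fin d) (Fin d) ℂ} (hA : A.IsHermitian) (t : ℝ) :
    (trace (mpow A t)).re = ∑ i, hA.eigenvalues i ^ t := by
  rw [mpow_eq hA, trace_mul_comm, ← mul_assoc, Unitary.coe_star_mul_self, one_mul, trace_diagonal,
    Complex.re_sum]
  simp

lemma mpow_isUnit {d : ℕ} {A : Matrix (Fin d) (Fin d) ℂ} (hA : A.PosDef) (t : ℝ) :
    IsUnit (mpow A t) := by
  refine IsUnit.of_mul_eq_one (mpow A (-t)) ?_
  rw [mpow_mul hA, add_neg_cancel, mpow_zero' hA.isHermitian]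

lemma mpow_continuous {d : ℕ} {A : Matrix (Fin d) (Fin d) ℂ} (hA : A.PosDef) :
    Continuous (fun t => mpow A t) := by
  simp_rw [mpow_eq hA.isHermitian]
  refine Continuous.mul (Continuous.mul continuous_const ?_) continuous_const
  refine Continuous.matrix_diagonal (continuous_pi fun i => ?_)
  refine Complex.continuous_ofReal.comp ?_
  exact Real.continuous_const_rpow (hA.eigenvalues_pos i).ne'

lemma trace_bounds {d : ℕ} [NeZero d] {A : Matrix (Fin d) (Fin d) ℂ} (hA : A.PosSemidef) {z : ℝ}
    (hz : 0 < z) : ‖A‖ ^ z ≤ (trace (mpow A z)).re ∧ (trace (mpow A z)).re ≤ d * ‖A‖ ^ z := by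
  rw [mpow_trace hA.isHermitian]
  constructor
  · have h := CStarAlgebra.norm_mem_spectrum_of_nonneg (nonneg_iff_posSemidef.2 hA)
    rw [hA.isHermitian.spectrum_real_eq_range_eigenvalues] at h
    obtain ⟨i, hi⟩ := h
    rw [← hi]
    exact Finset.single_le_sum (f := fun i => hA.isHermitian.eigenvalues i ^ z)
      (fun j _ => Real.rpow_nonneg (hA.eigenvalues_nonneg j) z) (Finset.mem_univ i)
  · calc ∑ i, hA.isHermitian.eigenvalues i ^ z ≤ ∑ i : Fin d, ‖A‖ ^ z := by
          refine Finset.sum_le_sum fun i _ => ?_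
          refine Real.rpow_le_rpow (hA.eigenvalues_nonneg i) ?_ hz.le
          exact (Real.le_norm_self _).trans
            (spectrum.norm_le_norm_of_mem (hA.isHermitian.eigenvalues_mem_spectrum_real i))
      _ = _ := by simp

lemma M_eq {d : ℕ} {ρ σ : Matrix (Fin d) (Fin d) ℂ} (hρ : ρ.PosDef) (hσ : σ.PosDef) (s t : ℝ) :
    mpow ρ s * mpow σ t * mpow ρ s = (mpow σ (t / 2) * mpow ρ s)ᴴ * (mpow σ (t / 2) * mpow ρ s) := by
  rw [conjTranspose_mul, mpow_herm hρ.isHermitian, mpow_herm hσ.isHermitian]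
  have : mpow σ t = mpow σ (t / 2) * mpow σ (t / 2) := by rw [mpow_mul hσ, add_halves]
  rw [this]
  simp only [mul_assoc]

lemma M_psd {d : ℕ} {ρ σ : Matrix (Fin d) (Fin d) ℂ} (hρ : ρ.PosDef) (hσ : σ.PosDef) (s t : ℝ) :
    (mpow ρ s * mpow σ t * mpow ρ s).PosSemidef := by
  rw [M_eq hρ hσ]
  exact posSemidef_conjTranspose_mul_self _

lemma M_norm_pos {d : ℕ} [NeZero d] {ρ σ : Matrix (Fin d) (Fin d) ℂ} (hρ : ρ.PosDef)
    (hσ : σ.PosDef) (s t : ℝ) : 0 < ‖mpow ρ s * mpow σ t * mpow ρ s‖ :=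
  norm_pos_iff.2
    (((mpow_isUnit hρ s).mul (mpow_isUnit hσ t)).mul (mpow_isUnit hρ s)).ne_zero

lemma Dmax_eq {d : ℕ} [NeZero d] {ρ σ : Matrix (Fin d) (Fin d) ℂ} (hρ : ρ.PosDef)
    (hσ : σ.PosDef) (t : ℝ) :
    Dmax (mpow ρ t) (mpow σ t)
      = Real.logb 2 ‖mpow ρ (t / 2) * mpow σ (-t) * mpow ρ (t / 2)‖ := by
  have hpos := M_norm_pos hρ hσ (t / 2) (-t)
  set N := ‖mpow ρ (t / 2) * mpow σ (-t) * mpow ρ (t / 2)‖ with hN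
  have key : {l : ℝ | 0 < l ∧ (l • mpow σ t - mpow ρ t).PosSemidef} = Set.Ici N := by
    ext l
    simp only [Set.mem_setOf_eq, Set.mem_Ici]
    have main : 0 < l → ((l • mpow σ t - mpow ρ t).PosSemidef ↔ N ≤ l) := by
      intro hl
      have hX : N = ‖(mpow σ (-t / 2) * mpow ρ (t / 2)) * (mpow σ (-t / 2) * mpow ρ (t / 2))ᴴ‖ := by
        rw [hN, M_eq hρ hσ, l2_opNorm_conjTranspose_mul_self]
        have := l2_opNorm_conjTranspose_mul_self (mpow σ (-t / 2) * mpow ρ (t / 2))ᴴ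
        rw [conjTranspose_conjTranspose, l2_opNorm_conjTranspose] at this
        exact this.symm
      rw [hX, CStarAlgebra.norm_le_iff_le_algebraMap _ hl.le
        (nonneg_iff_posSemidef.2 (posSemidef_self_mul_conjTranspose _)), Matrix.le_iff,
        ← IsUnit.posSemidef_star_left_conjugate_iff (mpow_isUnit hσ (-t / 2)),
        star_eq_conjTranspose, mpow_herm hσ.isHermitian, conjTranspose_mul,
        mpow_herm hσ.isHermitian, mpow_herm hρ.isHermitian]
      have e1 : mpow σ (-t / 2) * mpow σ t * mpow σ (-t / 2) = 1 := by
        rw [mpow_mul hσ, mpow_mul hσ, ← mpow_zero' hσ.isHermitian]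
        congr 1; ring
      have e2 : mpow ρ t = mpow ρ (t / 2) * mpow ρ (t / 2) := by rw [mpow_mul hρ, add_halves]
      have e3 : mpow σ (-t / 2) * (l • mpow σ t - mpow ρ t) * mpow σ (-t / 2)
          = algebraMap ℝ _ l -
            mpow σ (-t / 2) * mpow ρ (t / 2) * (mpow ρ (t / 2) * mpow σ (-t / 2)) := by
        rw [mul_sub, sub_mul, mul_smul_comm, smul_mul_assoc, e1, e2, Algebra.algebraMap_eq_smul_one]
        simp only [mul_assoc]
      rw [e3]
    constructor
    · rintro ⟨h1, h2⟩
      exact (main h1).1 h2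
    · intro h
      have hl := hpos.trans_le h
      exact ⟨hl, (main hl).2 h⟩
  rw [Dmax, key, csInf_Ici]

lemma Dent_bounds {d : ℕ} [NeZero d] {ρ σ : Matrix (Fin d) (Fin d) ℂ} (hρ : ρ.PosDef)
    (hσ : σ.PosDef) {α z : ℝ} (hα : 1 < α) (hz : 0 < z) :
    z / (α - 1) * Real.logb 2
        ‖mpow ρ (α / (2 * z)) * mpow σ ((1 - α) / z) * mpow ρ (α / (2 * z))‖
      - (α - 1)⁻¹ * Real.logb 2 (trace ρ).re ≤ Dent α z ρ σ ∧
    Dent α z ρ σ ≤ z / (α - 1) * Real.logb 2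
        ‖mpow ρ (α / (2 * z)) * mpow σ ((1 - α) / z) * mpow ρ (α / (2 * z))‖
      + (α - 1)⁻¹ * (Real.logb 2 d - Real.logb 2 (trace ρ).re) := by
  have hpos := M_norm_pos hρ hσ (α / (2 * z)) ((1 - α) / z)
  obtain ⟨h1, h2⟩ := trace_bounds (M_psd hρ hσ (α / (2 * z)) ((1 - α) / z)) hz
  rw [Dent, traceFun]
  set N := ‖mpow ρ (α / (2 * z)) * mpow σ ((1 - α) / z) * mpow ρ (α / (2 * z))‖
  set T := (trace (mpow (mpow ρ (α / (2 * z)) * mpow σ ((1 - α) / z) * mpow ρ (α / (2 * z))) z)).re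
  have hNz : 0 < N ^ z := Real.rpow_pos_of_pos hpos z
  have hT : 0 < T := hNz.trans_le h1
  have hc : 0 < (trace ρ).re := (Complex.pos_iff.1 hρ.trace_pos).1
  have hd : (0 : ℝ) < d := Nat.cast_pos.2 (NeZero.pos d)
  have ha : 0 < (α - 1)⁻¹ := inv_pos.2 (by linarith)
  rw [Real.logb_div hT.ne' hc.ne']
  have l1 : z * Real.logb 2 N ≤ Real.logb 2 T := by
    rw [← Real.logb_rpow_eq_mul_logb_of_pos hpos]
    exact Real.logb_le_logb_of_le (by norm_num) hNz h1
  have l2 : Real.logb 2 T ≤ Real.logb 2 d + z * Real.logb 2 N := by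
    rw [← Real.logb_rpow_eq_mul_logb_of_pos hpos, ← Real.logb_mul hd.ne' hNz.ne']
    exact Real.logb_le_logb_of_le (by norm_num) hT h2
  have m1 := mul_le_mul_of_nonneg_left l1 ha.le
  have m2 := mul_le_mul_of_nonneg_left l2 ha.le
  rw [div_eq_mul_inv]
  constructor <;> nlinarith

lemma tendsto_main {d : ℕ} [NeZero d] {ρ σ : Matrix (Fin d) (Fin d) ℂ} (hρ : ρ.PosDef)
    (hσ : σ.PosDef) {r : ℝ} (hr : 0 < r) (z : ℝ → ℝ)
    (hz : Tendsto (fun α => z α / (α - 1)) atTop (𝓝 r)) :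
    Tendsto (fun α : ℝ => Dent α (z α) ρ σ) atTop
      (𝓝 (r * Dmax (mpow ρ (1 / r)) (mpow σ (1 / r)))) := by
  have hinv : Tendsto (fun α : ℝ => (α - 1)⁻¹) atTop (𝓝 0) :=
    tendsto_inv_atTop_zero.comp (tendsto_atTop_add_const_right _ (-1) tendsto_id)
  have hzi := hz.inv₀ hr.ne'
  have hgt : ∀ᶠ α : ℝ in atTop, 1 < α := eventually_gt_atTop 1
  have hzpos : ∀ᶠ α : ℝ in atTop, 0 < z α := by
    filter_upwards [hgt, hz.eventually (lt_mem_nhds hr)] with α h1 h2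
    have := mul_pos h2 (sub_pos.2 h1)
    rwa [div_mul_cancel₀ _ (sub_pos.2 h1).ne'] at this
  have ht : Tendsto (fun α => (1 - α) / z α) atTop (𝓝 (-(1 / r))) := by
    have : (fun α => (1 - α) / z α) = fun α => -(z α / (α - 1))⁻¹ := by
      ext α
      rw [inv_div, ← neg_div, neg_sub]
    rw [this, one_div]
    exact hzi.neg
  have hs : Tendsto (fun α => α / (2 * z α)) atTop (𝓝 (1 / r / 2)) := by
    have h2 : Tendsto (fun α : ℝ => (1 + (α - 1)⁻¹) * (z α / (α - 1))⁻¹ / 2) atTop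
        (𝓝 ((1 + 0) * r⁻¹ / 2)) := ((hinv.const_add 1).mul hzi).div_const 2
    have e : (1 + 0) * r⁻¹ / 2 = 1 / r / 2 := by rw [one_div]; ring
    rw [e] at h2
    refine h2.congr' ?_
    filter_upwards [hgt, hzpos] with α h1 h2
    have : α - 1 ≠ 0 := (sub_pos.2 h1).ne'
    field_simp
    ring
  have hN : Tendsto (fun α => ‖mpow ρ (α / (2 * z α)) * mpow σ ((1 - α) / z α) *
      mpow ρ (α / (2 * z α))‖) atTop
      (𝓝 ‖mpow ρ (1 / r / 2) * mpow σ (-(1 / r)) * mpow ρ (1 / r / 2)‖) := by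
    have a := ((mpow_continuous hρ).tendsto _).comp hs
    have b := ((mpow_continuous hσ).tendsto _).comp ht
    exact ((a.mul b).mul a).norm
  have hL := hz.mul (hN.logb (b := 2) (M_norm_pos hρ hσ _ _).ne')
  rw [Dmax_eq hρ hσ]
  refine tendsto_of_tendsto_of_tendsto_of_le_of_le'
    (g := fun α => z α / (α - 1) * Real.logb 2
        ‖mpow ρ (α / (2 * z α)) * mpow σ ((1 - α) / z α) * mpow ρ (α / (2 * z α))‖
      - (α - 1)⁻¹ * Real.logb 2 (trace ρ).re)
    (h := fun α => z α / (α - 1) * Real.logb 2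
        ‖mpow ρ (α / (2 * z α)) * mpow σ ((1 - α) / z α) * mpow ρ (α / (2 * z α))‖
      + (α - 1)⁻¹ * (Real.logb 2 d - Real.logb 2 (trace ρ).re)) ?_ ?_ ?_ ?_
  · simpa using hL.sub (hinv.mul_const (Real.logb 2 (trace ρ).re))
  · simpa using hL.add (hinv.mul_const (Real.logb 2 d - Real.logb 2 (trace ρ).re))
  · filter_upwards [hgt, hzpos] with α h1 h2
    exact (Dent_bounds hρ hσ h1 h2).1
  · filter_upwards [hgt, hzpos] with α h1 h2
    exact (Dent_bounds hρ hσ h1 h2).2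

lemma Dmax_zero (A B : Matrix (Fin 0) (Fin 0) ℂ) : Dmax A B = 0 := by
  have key : {l : ℝ | 0 < l ∧ (l • B - A).PosSemidef} = Set.Ioi 0 := by
    ext l
    simp only [Set.mem_setOf_eq, Set.mem_Ioi, and_iff_left_iff_imp]
    intro _
    rw [Subsingleton.elim (l • B - A) 0]
    exact PosSemidef.zero
  rw [Dmax, key, csInf_Ioi, Real.logb_zero]

lemma Dent_zero (α z : ℝ) (A B : Matrix (Fin 0) (Fin 0) ℂ) : Dent α z A B = 0 := by
  simp [Dent, trace]

end Helpers

/-- For positive definite ρ, σ and r > 0,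
`lim_{α→∞} D_{α,r(α-1)}(ρ‖σ) = r·D_max(ρ^{1/r}‖σ^{1/r})`; in particular (for r = 1)
the α-quantum Rényi divergence `D_{α,α}` tends to `D_max(ρ‖σ)` as α → ∞. -/
theorem limit_Dent_infty {d : ℕ} (ρ σ : Matrix (Fin d) (Fin d) ℂ)
    (hρ : ρ.PosDef) (hσ : σ.PosDef) (r : ℝ) (hr : 0 < r) :
    Filter.Tendsto (fun α : ℝ => Dent α (r * (α - 1)) ρ σ) Filter.atTop
      (nhds (r * Dmax (mpow ρ (1 / r)) (mpow σ (1 / r)))) ∧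
    Filter.Tendsto (fun α : ℝ => Dent α α ρ σ) Filter.atTop (nhds (Dmax ρ σ)) := by
  rcases Nat.eq_zero_or_pos d with rfl | hd
  · simp only [Dent_zero, Dmax_zero, mul_zero]
    exact ⟨tendsto_const_nhds, tendsto_const_nhds⟩
  · haveI : NeZero d := ⟨hd.ne'⟩
    constructor
    · refine tendsto_main hρ hσ hr (fun α => r * (α - 1)) ?_
      refine tendsto_const_nhds.congr' ?_
      filter_upwards [eventually_gt_atTop 1] with α h
      rw [mul_div_cancel_right₀ _ (sub_pos.2 h).ne']
    · have h := tendsto_main hρ hσ one_pos (fun α => α) ?_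
      · simpa only [div_one, one_mul, mpow_one' hρ.isHermitian, mpow_one' hσ.isHermitian] using h
      · have hinv : Tendsto (fun α : ℝ => 1 + (α - 1)⁻¹) atTop (nhds (1 + 0)) :=
          (tendsto_inv_atTop_zero.comp
            (tendsto_atTop_add_const_right _ (-1) tendsto_id)).const_add 1
        rw [add_zero] at hinv
        refine hinv.congr' ?_
        filter_upwards [eventually_gt_atTop 1] with α h
        have : α - 1 ≠ 0 := (sub_pos.2 h).ne'
        field_simp
        ring
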